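/- arXiv:1704.00481 — 2 statements merged into one kernel-verified Lean document; each statement's English description precedes it below -/
import Mathlib

section
/- Let T > 0, I = [0,T], let b : I × ℝ^d → ℝ^d be a bounded Borel vector field, let μ̄ be a nonnegative locally finite Borel measure on ℝ^d, and let F : ℝ^d → Γ be a Borel function such that for μ̄-a.e. x ∈ ℝ^d the curve F(x) is an integral curve of b with F(x)(0) = x. Define Φ_t(x) := F(x)(t). Then the family μ_t := (Φ_t)_# μ̄ is a measurable family of nonnegative locally finite Borel measures solving ∂_t μ_t + div(b μ_t) = 0 with initial data μ̄. -/
open MeasureTheory Set Metric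

noncomputable section

/-- The space `C(I; E)` of continuous curves on `I = [0,T]`, with the sup metric. -/
abbrev Curve (T : ℝ) (E : Type*) [MetricSpace E] := C(Set.Icc (0:ℝ) T, E)

instance (T : ℝ) (E : Type*) [MetricSpace E] : MeasurableSpace (Curve T E) := borel _
instance (T : ℝ) (E : Type*) [MetricSpace E] : BorelSpace (Curve T E) := ⟨rfl⟩

/-- `Γ = Lip_M(I; E)` : the curves that are Lipschitz with constant `M`, as a metric
subspace of `C(I; E)`. -/
abbrev LipCurve (T : ℝ) (E : Type*) [MetricSpace E] (M : NNReal) :=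
  {γ : Curve T E // LipschitzWith M γ}

/-- Evaluation of a curve `γ ∈ C([0,T]; E)` at a time `t : ℝ` (clamping `t` to `[0,T]`). -/
def evalC {T : ℝ} {E : Type*} [MetricSpace E] (hT : 0 ≤ T) (γ : Curve T E) (t : ℝ) : E :=
  γ (Set.projIcc 0 T hT t)

/-- `γ` is an integral curve of `b`: `γ(t) = γ(0) + ∫₀ᵗ b(s, γ(s)) ds` for all `t ∈ [0,T]`. -/
def IsIntegralCurveOf {T : ℝ} {E : Type*} [NormedAddCommGroup E] [NormedSpace ℝ E]
    (hT : 0 ≤ T) (b : ℝ → E → E) (γ : Curve T E) : Prop :=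
  ∀ t ∈ Set.Icc (0:ℝ) T,
    evalC hT γ t = evalC hT γ 0 + ∫ s in (0:ℝ)..t, b s (evalC hT γ s)

/-- A family `{μ_t}` of Borel measures is measurable: `t ↦ μ_t(B)` is (Lebesgue-)measurable
for every bounded Borel set `B`, and `t ↦ μ_t(K)` is integrable on `[0,T]` for every
compact `K`. -/
def IsMeasurableFamily {E : Type*} [NormedAddCommGroup E] [MeasurableSpace E]
    (T : ℝ) (μ : ℝ → Measure E) : Prop :=
  (∀ B : Set E, MeasurableSet B → Bornology.IsBounded B →
      AEMeasurable (fun t => μ t B) (volume.restrict (Set.Icc (0:ℝ) T))) ∧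
  (∀ K : Set E, IsCompact K →
      IntegrableOn (fun t => (μ t K).toReal) (Set.Icc (0:ℝ) T))

/-- `{μ_t}` is a measure-valued solution of `∂_t μ_t + div (b μ_t) = 0`, `μ_t|_{t=0} = μ₀`:
for every `C¹` test function `φ(t,x)` vanishing for `(t,x) ∈ [0,T] × (E ∖ B_R(0))` for
some `R > 0`, and a.e. `t ∈ [0,T]`,
`∫ φ(t,x) dμ_t(x) = ∫ φ(0,x) dμ₀(x) + ∫₀ᵗ ∫ (∂_t φ + b ⬝ ∇_x φ) dμ_s ds`. -/
def IsMVSolution {E : Type*} [NormedAddCommGroup E] [NormedSpace ℝ E] [MeasurableSpace E]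
    (T : ℝ) (b : ℝ → E → E) (μ : ℝ → Measure E) (μ₀ : Measure E) : Prop :=
  ∀ φ : ℝ × E → ℝ, ContDiff ℝ 1 φ →
    (∃ R > (0:ℝ), ∀ t ∈ Set.Icc (0:ℝ) T, ∀ x : E, R ≤ ‖x‖ → φ (t, x) = 0) →
    ∀ᵐ t ∂(volume.restrict (Set.Icc (0:ℝ) T)),
      ∫ x, φ (t, x) ∂(μ t) =
        (∫ x, φ (0, x) ∂μ₀) +
          ∫ s in (0:ℝ)..t, (∫ x, (deriv (fun τ => φ (τ, x)) s
            + fderiv ℝ (fun y => φ (s, y)) x (b s x)) ∂(μ s))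


section SpaceTime

open Filter Topology

variable {E : Type*} [NormedAddCommGroup E] [NormedSpace ℝ E]

/-- The chain rule in integral form for a `C¹` function along a Lipschitz primitive curve. -/
theorem integral_fderiv_along_curve [CompleteSpace E] {φ : ℝ × E → ℝ} (hφ : ContDiff ℝ 1 φ)
    {γ v : ℝ → E} {K : NNReal} {t : ℝ} (hγ : LipschitzOnWith K γ (uIcc 0 t))
    (hv : IntervalIntegrable v volume 0 t)
    (hγv : ∀ s ∈ uIcc 0 t, γ s = γ 0 + ∫ r in (0:ℝ)..s, v r) :
    ∫ s in (0:ℝ)..t, fderiv ℝ φ (s, γ s) (1, v s) = φ (t, γ t) - φ (0, γ 0) := by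
  have hpair : LipschitzOnWith (max 1 K) (fun s => (s, γ s)) (uIcc 0 t) :=
    LipschitzWith.id.lipschitzOnWith.prodMk hγ
  obtain ⟨L, hL⟩ := (hφ.locallyLipschitz.locallyLipschitzOn
    (s := (fun s => (s, γ s)) '' uIcc 0 t)).exists_lipschitzOnWith_of_compact
      (isCompact_uIcc.image_of_continuousOn hpair.continuousOn)
  have hac : AbsolutelyContinuousOnInterval (fun s => φ (s, γ s)) 0 t :=
    (hL.comp hpair (mapsTo_image _ _)).absolutelyContinuousOnInterval
  rw [← hac.integral_deriv_eq_sub]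
  have hne0 : ∀ᵐ s : ℝ, s ≠ 0 := by simp [ae_iff, measure_singleton]
  have hnet : ∀ᵐ s : ℝ, s ≠ t := by simp [ae_iff, measure_singleton]
  apply intervalIntegral.integral_congr_ae
  filter_upwards [hv.ae_hasDerivAt_integral, hne0, hnet] with s hs hs0 hst hmem
  have hnhds : uIcc 0 t ∈ 𝓝 s := by
    rcases le_total 0 t with h | h
    · rw [uIoc_of_le h] at hmem
      rw [uIcc_of_le h]
      exact Icc_mem_nhds hmem.1 (lt_of_le_of_ne hmem.2 hst)
    · rw [uIoc_of_ge h] at hmem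
      rw [uIcc_of_ge h]
      exact Icc_mem_nhds hmem.1 (lt_of_le_of_ne hmem.2 hs0)
  have hder : HasDerivAt γ (v s) s :=
    ((hs (uIoc_subset_uIcc hmem) 0 left_mem_uIcc).const_add (γ 0)).congr_of_eventuallyEq
      (eventually_of_mem hnhds hγv)
  exact (((hφ.differentiable one_ne_zero _).hasFDerivAt).comp_hasDerivAt s
    ((hasDerivAt_id s).prodMk hder)).deriv.symm

theorem deriv_add_fderiv_eq_fderiv_prod {φ : ℝ × E → ℝ} {s : ℝ} {x : E}
    (hφ : DifferentiableAt ℝ φ (s, x)) (w : E) :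
    deriv (fun τ => φ (τ, x)) s + fderiv ℝ (fun y => φ (s, y)) x w =
      fderiv ℝ φ (s, x) (1, w) := by
  have h1 : HasDerivAt (fun τ => φ (τ, x)) (fderiv ℝ φ (s, x) (1, 0)) s :=
    hφ.hasFDerivAt.comp_hasDerivAt s ((hasDerivAt_id s).prodMk (hasDerivAt_const s x))
  have h2 : HasFDerivAt (fun y => φ (s, y))
      ((fderiv ℝ φ (s, x)).comp (ContinuousLinearMap.inr ℝ ℝ E)) x :=
    hφ.hasFDerivAt.comp x (hasFDerivAt_prodMk_right s x)
  rw [h1.deriv, h2.fderiv, ContinuousLinearMap.comp_apply, ContinuousLinearMap.inr_apply,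
    ← map_add]
  simp

theorem fderiv_eq_zero_of_vanishing {φ : ℝ × E → ℝ} {T R : ℝ}
    (hφ : ∀ t ∈ Icc (0:ℝ) T, ∀ x : E, R ≤ ‖x‖ → φ (t, x) = 0) {s : ℝ} (hs : s ∈ Ioo 0 T) {y : E}
    (hy : R < ‖y‖) : fderiv ℝ φ (s, y) = 0 := by
  have h : φ =ᶠ[𝓝 (s, y)] fun _ => 0 := by
    filter_upwards [prod_mem_nhds (Ioo_mem_nhds hs.1 hs.2)
      ((isOpen_lt continuous_const continuous_norm).mem_nhds hy)] with p hp
    exact hφ p.1 (Ioo_subset_Icc_self hp.1) p.2 (le_of_lt hp.2)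
  rw [h.fderiv_eq]
  simp

theorem exists_norm_fderiv_le [ProperSpace E] {φ : ℝ × E → ℝ} (hφ : ContDiff ℝ 1 φ) {T R : ℝ}
    (hφR : ∀ t ∈ Icc (0:ℝ) T, ∀ x : E, R ≤ ‖x‖ → φ (t, x) = 0) :
    ∃ C : ℝ, 0 ≤ C ∧ ∀ s ∈ Ioo 0 T, ∀ y, ‖fderiv ℝ φ (s, y)‖ ≤ C := by
  obtain ⟨C, hC⟩ := (isCompact_Icc.prod (isCompact_closedBall (0:E) R)).exists_bound_of_continuousOn
    (hφ.continuous_fderiv one_ne_zero).continuousOn (s := Icc 0 T ×ˢ closedBall (0:E) R)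
  refine ⟨max C 0, le_max_right _ _, fun s hs y => ?_⟩
  rcases le_or_gt ‖y‖ R with h | h
  · exact (hC (s, y) ⟨Ioo_subset_Icc_self hs, by simpa using h⟩).trans (le_max_left _ _)
  · simp [fderiv_eq_zero_of_vanishing hφR hs h]

theorem evalC_lipschitz {E : Type*} [MetricSpace E] {T : ℝ} (hT : 0 ≤ T) {M : NNReal}
    (γ : LipCurve T E M) : LipschitzWith M (evalC hT γ.1) := by
  have h := γ.2.comp (LipschitzWith.projIcc hT)
  rwa [mul_one] at h

theorem measurable_evalC {X E : Type*} [MeasurableSpace X] [MetricSpace E]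
    [MeasurableSpace E] [BorelSpace E] {T : ℝ} (hT : 0 ≤ T) {M : NNReal}
    {F : X → LipCurve T E M} (hF : Measurable F) (t : ℝ) :
    Measurable (fun x => evalC hT (F x).1 t) :=
  (continuous_eval_const (F := Curve T E) (projIcc 0 T hT t)).measurable.comp
    (measurable_subtype_coe.comp hF)

theorem measurable_uncurry_evalC {X E : Type*} [MeasurableSpace X] [MetricSpace E]
    [MeasurableSpace E] [BorelSpace E] {T : ℝ} (hT : 0 ≤ T) {M : NNReal}
    {F : X → LipCurve T E M} (hF : Measurable F) :
    Measurable (Function.uncurry fun t x => evalC hT (F x).1 t) :=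
  measurable_uncurry_of_continuous_of_measurable
    (fun x => (evalC_lipschitz hT (F x)).continuous) (measurable_evalC hT hF)

theorem norm_evalC_sub_le {E : Type*} [NormedAddCommGroup E] {T : ℝ} (hT : 0 ≤ T) {M : NNReal}
    (γ : LipCurve T E M) {t : ℝ} (ht : t ∈ Icc 0 T) :
    ‖evalC hT γ.1 t - evalC hT γ.1 0‖ ≤ M * T := by
  have h := (evalC_lipschitz hT γ).dist_le_mul t 0
  rw [dist_eq_norm, Real.dist_0_eq_abs, abs_of_nonneg ht.1] at h
  exact h.trans (by gcongr; exact ht.2)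

end SpaceTime

section Flow

variable {E : Type*} [NormedAddCommGroup E] [MeasurableSpace E] [BorelSpace E]
  {T : ℝ} (hT : 0 ≤ T) {M : NNReal}
  {F : E → LipCurve T E M} {μ₀ : Measure E}

theorem map_evalC_closedBall_le (hF : Measurable F)
    (hF0 : ∀ᵐ x ∂μ₀, evalC hT (F x).1 0 = x) {t : ℝ} (ht : t ∈ Icc 0 T) (y : E) (R : ℝ) :
    μ₀.map (fun x => evalC hT (F x).1 t) (closedBall y R) ≤ μ₀ (closedBall y (R + M * T)) := by
  rw [Measure.map_apply (measurable_evalC hT hF t) measurableSet_closedBall]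
  apply measure_mono_ae
  filter_upwards [hF0] with x hx hxR
  have h := norm_evalC_sub_le hT (F x) ht
  rw [hx, ← dist_eq_norm, dist_comm] at h
  exact (dist_triangle _ _ _).trans ((add_le_add h hxR).trans_eq (add_comm _ _))

variable [ProperSpace E] [IsLocallyFiniteMeasure μ₀]

theorem isLocallyFiniteMeasure_map_evalC (hF : Measurable F)
    (hF0 : ∀ᵐ x ∂μ₀, evalC hT (F x).1 0 = x) {t : ℝ} (ht : t ∈ Icc 0 T) :
    IsLocallyFiniteMeasure (μ₀.map (fun x => evalC hT (F x).1 t)) :=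
  ⟨fun y => ⟨closedBall y 1, closedBall_mem_nhds y one_pos,
    (map_evalC_closedBall_le hT hF hF0 ht y 1).trans_lt measure_closedBall_lt_top⟩⟩

theorem measurable_map_evalC (hF : Measurable F) {B : Set E} (hB : MeasurableSet B) :
    Measurable (fun t => μ₀.map (fun x => evalC hT (F x).1 t) B) := by
  simp_rw [Measure.map_apply (measurable_evalC hT hF _) hB]
  exact measurable_measure_prodMk_left (measurable_uncurry_evalC hT hF hB)

theorem isMeasurableFamily_map_evalC (hF : Measurable F)
    (hF0 : ∀ᵐ x ∂μ₀, evalC hT (F x).1 0 = x) :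
    IsMeasurableFamily T (fun t => μ₀.map (fun x => evalC hT (F x).1 t)) := by
  refine ⟨fun B hB _ => (measurable_map_evalC hT hF hB).aemeasurable, fun K hK => ?_⟩
  obtain ⟨R, hR⟩ := hK.isBounded.subset_closedBall 0
  refine Integrable.mono' (g := fun _ => μ₀.real (closedBall 0 (R + M * T)))
    (integrable_const _)
    (measurable_map_evalC hT hF hK.measurableSet).ennreal_toReal.aestronglyMeasurable ?_
  filter_upwards [ae_restrict_mem measurableSet_Icc] with t ht
  rw [Real.norm_of_nonneg ENNReal.toReal_nonneg]
  exact ENNReal.toReal_mono measure_closedBall_lt_top.ne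
    ((measure_mono hR).trans (map_evalC_closedBall_le hT hF hF0 ht 0 R))

variable {b : ℝ → E → E}

theorem intervalIntegrable_field_along_curve
    (hb : Measurable (Function.uncurry b)) (hbM : ∀ t ∈ Icc (0:ℝ) T, ∀ x, ‖b t x‖ ≤ M)
    (γ : LipCurve T E M) {t : ℝ} (ht : t ∈ Icc 0 T) :
    IntervalIntegrable (fun s => b s (evalC hT γ.1 s)) volume 0 t := by
  have hmeas : Measurable (fun s => b s (evalC hT γ.1 s)) :=
    hb.comp (measurable_id.prodMk (evalC_lipschitz hT γ).continuous.measurable)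
  refine (intervalIntegrable_const (c := (M:ℝ))).mono_fun' hmeas.aestronglyMeasurable ?_
  filter_upwards [ae_restrict_mem measurableSet_uIoc] with s hs
  rw [uIoc_of_le ht.1] at hs
  exact hbM s ⟨hs.1.le, hs.2.trans ht.2⟩ _

variable [NormedSpace ℝ E]

theorem measurable_fderiv_apply_field {φ : ℝ × E → ℝ} (hφ : ContDiff ℝ 1 φ)
    (hb : Measurable (Function.uncurry b)) :
    Measurable (fun p : ℝ × E => fderiv ℝ φ p (1, b p.1 p.2)) := by
  have hc : Continuous fun q : (ℝ × E) × E => fderiv ℝ φ q.1 (1, q.2) :=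
    ((hφ.continuous_fderiv one_ne_zero).comp continuous_fst).clm_apply
      (continuous_const.prodMk continuous_snd)
  exact hc.measurable.comp (measurable_id.prodMk hb)

theorem integrable_fderiv_along_flow {φ : ℝ × E → ℝ} (hφ : ContDiff ℝ 1 φ) {R : ℝ}
    (hφR : ∀ t ∈ Icc (0:ℝ) T, ∀ x : E, R ≤ ‖x‖ → φ (t, x) = 0)
    (hb : Measurable (Function.uncurry b)) (hbM : ∀ t ∈ Icc (0:ℝ) T, ∀ x, ‖b t x‖ ≤ M)
    (hF : Measurable F) (hF0 : ∀ᵐ x ∂μ₀, evalC hT (F x).1 0 = x) {t : ℝ} (ht : t ∈ Ioo 0 T) :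
    Integrable (Function.uncurry fun s x =>
      fderiv ℝ φ (s, evalC hT (F x).1 s) (1, b s (evalC hT (F x).1 s)))
      ((volume.restrict (uIoc 0 t)).prod μ₀) := by
  obtain ⟨C, hC0, hC⟩ := exists_norm_fderiv_le hφ hφR
  have hmeas : Measurable (Function.uncurry fun s x =>
      fderiv ℝ φ (s, evalC hT (F x).1 s) (1, b s (evalC hT (F x).1 s))) :=
    (measurable_fderiv_apply_field hφ hb).comp
      (measurable_fst.prodMk (measurable_uncurry_evalC hT hF))
  have hball : Integrable ((univ ×ˢ closedBall (0:E) (R + M * T)).indicator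
      fun _ => C * max 1 (M:ℝ)) ((volume.restrict (uIoc 0 t)).prod μ₀) := by
    refine (integrable_indicator_iff (MeasurableSet.univ.prod measurableSet_closedBall)).2 ?_
    refine integrableOn_const ?_
    rw [Measure.prod_prod]
    exact (ENNReal.mul_lt_top (by simp [uIoc_of_le ht.1.le]) measure_closedBall_lt_top).ne
  refine hball.mono' hmeas.aestronglyMeasurable ?_
  filter_upwards [Measure.quasiMeasurePreserving_fst.ae (ae_restrict_mem measurableSet_uIoc),
    Measure.quasiMeasurePreserving_snd.ae hF0] with p hp1 hp2
  obtain ⟨s, x⟩ := p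
  rw [uIoc_of_le ht.1.le] at hp1
  have hs : s ∈ Ioo 0 T := ⟨hp1.1, hp1.2.trans_lt ht.2⟩
  have hsI := Ioo_subset_Icc_self hs
  simp only [Function.uncurry_apply_pair]
  by_cases hx : x ∈ closedBall (0:E) (R + M * T)
  · rw [indicator_of_mem (mk_mem_prod (mem_univ _) hx)]
    refine (ContinuousLinearMap.le_opNorm _ _).trans ?_
    gcongr
    · exact hC s hs _
    · rw [Prod.norm_mk, norm_one]
      exact max_le_max le_rfl (hbM s hsI _)
  · have h : R < ‖evalC hT (F x).1 s‖ := by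
      have h1 := norm_evalC_sub_le hT (F x) hsI
      dsimp only at hp2
      rw [hp2, norm_sub_rev] at h1
      have h2 := norm_sub_norm_le x (evalC hT (F x).1 s)
      rw [mem_closedBall_zero_iff, not_le] at hx
      linarith
    rw [fderiv_eq_zero_of_vanishing hφR hs h, indicator_of_notMem (fun hmem => hx hmem.2)]
    simp

theorem isMVSolution_map_evalC
    (hb : Measurable (Function.uncurry b)) (hbM : ∀ t ∈ Icc (0:ℝ) T, ∀ x, ‖b t x‖ ≤ M)
    (hF : Measurable F)
    (hflow : ∀ᵐ x ∂μ₀, IsIntegralCurveOf hT b (F x).1 ∧ evalC hT (F x).1 0 = x) :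
    IsMVSolution T b (fun t => μ₀.map (fun x => evalC hT (F x).1 t)) μ₀ := by
  rintro φ hφ ⟨R, -, hφR⟩
  have hF0 : ∀ᵐ x ∂μ₀, evalC hT (F x).1 0 = x := hflow.mono fun _ h => h.2
  rw [← Measure.restrict_congr_set Ioo_ae_eq_Icc]
  filter_upwards [ae_restrict_mem measurableSet_Ioo] with t ht
  have htI := Ioo_subset_Icc_self ht
  have hint := integrable_fderiv_along_flow hT hφ hφR hb hbM hF hF0 ht
  have hφ0 : Integrable (fun x => φ (0, x)) μ₀ := by
    refine (hφ.continuous.comp (Continuous.prodMk_right 0)).integrable_of_hasCompactSupport ?_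
    refine HasCompactSupport.intro (isCompact_closedBall (0:E) R) fun x hx => ?_
    rw [mem_closedBall_zero_iff, not_le] at hx
    exact hφR 0 (left_mem_Icc.2 hT) x hx.le
  have hswap : ∀ s, ∫ x, (deriv (fun τ => φ (τ, x)) s
      + fderiv ℝ (fun y => φ (s, y)) x (b s x)) ∂(μ₀.map (fun x => evalC hT (F x).1 s)) =
      ∫ x, fderiv ℝ φ (s, evalC hT (F x).1 s) (1, b s (evalC hT (F x).1 s)) ∂μ₀ := fun s => by
    simp_rw [deriv_add_fderiv_eq_fderiv_prod (hφ.differentiable one_ne_zero _)]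
    exact integral_map (measurable_evalC hT hF s).aemeasurable
      ((measurable_fderiv_apply_field hφ hb).comp measurable_prodMk_left).aestronglyMeasurable
  have hright : Integrable (fun x => ∫ s in (0:ℝ)..t,
      fderiv ℝ φ (s, evalC hT (F x).1 s) (1, b s (evalC hT (F x).1 s))) μ₀ := by
    simp_rw [intervalIntegral.integral_of_le ht.1.le]
    rw [uIoc_of_le ht.1.le] at hint
    exact hint.integral_prod_right
  have hφt : Continuous fun x => φ (t, x) := hφ.continuous.comp (Continuous.prodMk_right t)
  simp_rw [hswap]
  rw [intervalIntegral_integral_swap hint, ← integral_add hφ0 hright,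
    integral_map (measurable_evalC hT hF t).aemeasurable
      hφt.aestronglyMeasurable]
  refine integral_congr_ae ?_
  filter_upwards [hflow] with x hx
  have hsub : uIcc 0 t ⊆ Icc 0 T := by
    rw [uIcc_of_le ht.1.le]
    exact Icc_subset_Icc_right ht.2.le
  rw [integral_fderiv_along_curve hφ (evalC_lipschitz hT (F x)).lipschitzOnWith
    (intervalIntegrable_field_along_curve hT hb hbM (F x) htI) (fun s hs => hx.1 s (hsub hs)),
    hx.2]
  ring

end Flow

/-- If `F : ℝ^d → Γ` is a Borel flow of `b` defined `μ̄`-a.e. and `Φ_t x := (F x)(t)`, then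
`μ_t := (Φ_t)_# μ̄` is a measurable family of nonnegative locally finite Borel measures solving
the continuity equation with initial datum `μ̄`. -/
theorem pushforward_by_flow_is_mvs
    (d : ℕ) (T : ℝ) (hT : 0 < T)
    (b : ℝ → EuclideanSpace ℝ (Fin d) → EuclideanSpace ℝ (Fin d))
    (hb_borel : Measurable (Function.uncurry b))
    (M : NNReal) (hb_bdd : ∀ t ∈ Set.Icc (0:ℝ) T, ∀ x, ‖b t x‖ ≤ M)
    (μ₀ : Measure (EuclideanSpace ℝ (Fin d))) [IsLocallyFiniteMeasure μ₀]
    (F : EuclideanSpace ℝ (Fin d) → LipCurve T (EuclideanSpace ℝ (Fin d)) M)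
    (hF_borel : Measurable F)
    (hF_flow : ∀ᵐ x ∂μ₀, IsIntegralCurveOf hT.le b (F x).1 ∧ evalC hT.le (F x).1 0 = x) :
    IsMeasurableFamily T (fun t => Measure.map (fun x => evalC hT.le (F x).1 t) μ₀) ∧
    (∀ t ∈ Set.Icc (0:ℝ) T,
      IsLocallyFiniteMeasure (Measure.map (fun x => evalC hT.le (F x).1 t) μ₀)) ∧
    IsMVSolution T b (fun t => Measure.map (fun x => evalC hT.le (F x).1 t) μ₀) μ₀ := by
  have hF0 : ∀ᵐ x ∂μ₀, evalC hT.le (F x).1 0 = x := hF_flow.mono fun _ h => h.2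
  exact ⟨isMeasurableFamily_map_evalC hT.le hF_borel hF0,
    fun _ ht => isLocallyFiniteMeasure_map_evalC hT.le hF_borel hF0 ht,
    isMVSolution_map_evalC hT.le hb_borel hb_bdd hF_borel hF_flow⟩

end
end

section
/- Let T > 0, I = [0,T], let b : I × ℝ^d → ℝ^d be a bounded Borel vector field, Γ = Lip_{‖b‖_∞}(I;ℝ^d) with the supremum metric, and let η be a σ-finite nonnegative Borel measure on Γ. Then the set Γ_b of integral curves of b is η-measurable (measurable with respect to the completion of η). -/
open MeasureTheory Set Metric

noncomputable section

theorem continuous_evalC {T : ℝ} {E : Type*} [MetricSpace E] (hT : 0 ≤ T) :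
    Continuous fun p : Curve T E × ℝ => evalC hT p.1 p.2 := by
  unfold evalC
  have h : Continuous (Set.projIcc 0 T hT) := continuous_projIcc
  exact continuous_eval.comp (continuous_fst.prodMk (h.comp continuous_snd))

theorem measurable_comp_evalC {T : ℝ} {E : Type*} [NormedAddCommGroup E] [MeasurableSpace E]
    [BorelSpace E] (hT : 0 ≤ T) {b : ℝ → E → E}
    (hb : Measurable (Function.uncurry b)) :
    Measurable fun p : Curve T E × ℝ => b p.2 (evalC hT p.1 p.2) :=
  hb.comp (measurable_snd.prodMk (continuous_evalC hT).measurable)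

section IntegralCurves

variable {T : ℝ} {E : Type*} [NormedAddCommGroup E] [NormedSpace ℝ E] [MeasurableSpace E]
  [BorelSpace E] [SecondCountableTopology E]

theorem measurable_integral_comp_evalC (hT : 0 ≤ T) {b : ℝ → E → E}
    (hb : Measurable (Function.uncurry b)) (t : ℝ) :
    Measurable fun γ : Curve T E => ∫ s in (0:ℝ)..t, b s (evalC hT γ s) := by
  have h := (measurable_comp_evalC hT hb).stronglyMeasurable
  unfold intervalIntegral
  exact (h.integral_prod_right'.sub h.integral_prod_right').measurable

theorem continuousOn_integral_comp_evalC (hT : 0 ≤ T) {b : ℝ → E → E}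
    (hb : Measurable (Function.uncurry b)) {M : ℝ}
    (hM : ∀ t ∈ Set.Icc (0:ℝ) T, ∀ x, ‖b t x‖ ≤ M) (γ : Curve T E) :
    ContinuousOn (fun t => ∫ s in (0:ℝ)..t, b s (evalC hT γ s)) (Set.Icc 0 T) := by
  have hint : IntegrableOn (fun s => b s (evalC hT γ s)) (Set.Icc 0 T) :=
    Measure.integrableOn_of_bounded (M := M) measure_Icc_lt_top.ne
      ((measurable_comp_evalC hT hb).comp measurable_prodMk_left).aestronglyMeasurable
      ((ae_restrict_iff' measurableSet_Icc).2 (.of_forall fun s hs => hM s hs _))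
  rw [← Set.uIcc_of_le hT] at hint ⊢
  exact intervalIntegral.continuousOn_primitive_interval hint

/-- The integral curves of a bounded Borel field form a Borel subset of the space of
continuous curves. -/
theorem measurableSet_isIntegralCurveOf (hT : 0 ≤ T) {b : ℝ → E → E}
    (hb : Measurable (Function.uncurry b)) {M : ℝ}
    (hM : ∀ t ∈ Set.Icc (0:ℝ) T, ∀ x, ‖b t x‖ ≤ M) :
    MeasurableSet {γ : Curve T E | IsIntegralCurveOf hT b γ} := by
  have : Nonempty (Set.Icc (0:ℝ) T) := ⟨⟨0, le_rfl, hT⟩⟩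
  have heval (t : ℝ) : Measurable fun γ : Curve T E => evalC hT γ t :=
    ((continuous_evalC hT).comp (continuous_id.prodMk continuous_const)).measurable
  have hset : {γ : Curve T E | IsIntegralCurveOf hT b γ} =
      ⋂ n : ℕ, {γ : Curve T E | evalC hT γ (TopologicalSpace.denseSeq (Set.Icc (0:ℝ) T) n) =
        evalC hT γ 0 + ∫ s in (0:ℝ)..(TopologicalSpace.denseSeq (Set.Icc (0:ℝ) T) n),
          b s (evalC hT γ s)} := by
    ext γ
    simp only [Set.mem_ofPred_eq, Set.mem_iInter]
    refine ⟨fun h n => h _ (Subtype.prop _), fun h t ht => ?_⟩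
    have hleft : Continuous fun t : Set.Icc (0:ℝ) T => evalC hT γ t :=
      (continuous_evalC hT).comp (continuous_const.prodMk continuous_subtype_val)
    have hright : Continuous fun t : Set.Icc (0:ℝ) T =>
        evalC hT γ 0 + ∫ s in (0:ℝ)..t, b s (evalC hT γ s) :=
      continuous_const.add (continuousOn_integral_comp_evalC hT hb hM γ).domRestrict
    exact congrFun ((TopologicalSpace.denseRange_denseSeq _).equalizer hleft hright
      (funext h)) ⟨t, ht⟩
  rw [hset]
  exact .iInter fun n => measurableSet_eq_fun (heval _)
    ((heval 0).add (measurable_integral_comp_evalC hT hb _))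

end IntegralCurves

/-- For a σ-finite nonnegative Borel measure `η` on `Γ = Lip_{‖b‖_∞}([0,T]; ℝ^d)`, the set
`Γ_b` of integral curves of the bounded Borel field `b` is `η`-measurable, i.e. measurable
with respect to the completion of `η`. -/
theorem integralCurves_null_measurable
    (d : ℕ) (T : ℝ) (hT : 0 < T)
    (b : ℝ → EuclideanSpace ℝ (Fin d) → EuclideanSpace ℝ (Fin d))
    (hb_borel : Measurable (Function.uncurry b))
    (M : NNReal) (hb_bdd : ∀ t ∈ Set.Icc (0:ℝ) T, ∀ x, ‖b t x‖ ≤ M)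
    (η : Measure (LipCurve T (EuclideanSpace ℝ (Fin d)) M)) [SigmaFinite η] :
    NullMeasurableSet
      {γ : LipCurve T (EuclideanSpace ℝ (Fin d)) M | IsIntegralCurveOf hT.le b γ.1} η :=
  (measurable_subtype_coe (measurableSet_isIntegralCurveOf hT.le hb_borel hb_bdd)).nullMeasurableSet

end
end
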